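/- Let L₁, L₂ > 0, c > 0, λ ≥ 0, D > 0, p_out > 0 and κ ≠ 0 be real numbers. For i = 1,2 let ρᵢ, mᵢ : ℝ × ℝ → ℝ be continuously differentiable with ρᵢ(x,t) > 0 on [0,Lᵢ], satisfying the ISO2b equations ∂ₜρᵢ + ∂ₓmᵢ = 0 and ∂ₜmᵢ + ∂ₓ(c²ρᵢ) = −(λ/(2D))·mᵢ·|mᵢ/ρᵢ| for all x ∈ [0,Lᵢ] and all t. Assume the FP/AV compressor coupling conditions hold for all t: c²ρ₂(0,t) = p_out and m₁(L₁,t) = (c²ρ₁(L₁,t)/p_out)^(1/κ)·m₂(0,t). Let H(t) = ∫₀^{L₁} (c²ρ₁²/2 + m₁²/2) dx + ∫₀^{L₂} (c²ρ₂²/2 + m₂²/2) dx. Then for every t, H'(t) = c²ρ₁(0,t)·m₁(0,t) − c²ρ₂(L₂,t)·m₂(L₂,t) + (p_out − c²ρ₁(L₁,t)·(c²ρ₁(L₁,t)/p_out)^(1/κ))·m₂(0,t) − ∫₀^{L₁} (λ/(2D))·|m₁/ρ₁|·m₁² dx − ∫₀^{L₂} (λ/(2D))·|m₂/ρ₂|·m₂²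 dx. -/

import Mathlib

open intervalIntegral

/-- Partial derivatives of a differentiable function on `ℝ × ℝ` in its second variable. -/
lemma hasDerivAt_snd_of_differentiable {F : ℝ × ℝ → ℝ} (hF : Differentiable ℝ F) (x t : ℝ) :
    HasDerivAt (fun τ => F (x, τ)) (fderiv ℝ F (x, t) (0, 1)) t :=
  (hF (x, t)).hasFDerivAt.comp_hasDerivAt t ((hasDerivAt_const t x).prodMk (hasDerivAt_id t))

/-- Partial derivatives of a differentiable function on `ℝ × ℝ` in its first variable. -/
lemma hasDerivAt_fst_of_differentiable {F : ℝ × ℝ → ℝ} (hF : Differentiable ℝ F) (x t : ℝ) :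
    HasDerivAt (fun ξ => F (ξ, t)) (fderiv ℝ F (x, t) (1, 0)) x :=
  (hF (x, t)).hasFDerivAt.comp_hasDerivAt x ((hasDerivAt_id x).prodMk (hasDerivAt_const x t))

/-- Directional derivatives of a `C¹` function are continuous. -/
lemma continuous_fderiv_apply_const {F : ℝ × ℝ → ℝ} (hF : ContDiff ℝ 1 F) (v : ℝ × ℝ) :
    Continuous fun p => fderiv ℝ F p v :=
  (hF.continuous_fderiv one_ne_zero).clm_apply continuous_const

/-- Differentiation under the integral sign for a `C¹` integrand. -/
lemma hasDerivAt_intervalIntegral_of_contDiff {F : ℝ × ℝ → ℝ} (hF : ContDiff ℝ 1 F)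
    (a b t : ℝ) :
    HasDerivAt (fun τ => ∫ x in a..b, F (x, τ))
      (∫ x in a..b, fderiv ℝ F (x, t) (0, 1)) t := by
  have hF' := continuous_fderiv_apply_const hF (0, 1)
  obtain ⟨C, hC⟩ := (isCompact_uIcc.prod (isCompact_closedBall t 1)).exists_bound_of_continuousOn
    (s := Set.uIcc a b ×ˢ Metric.closedBall t 1) hF'.continuousOn
  have hcont : ∀ τ, Continuous fun x => F (x, τ) := fun τ => hF.continuous.comp (by fun_prop)
  refine (hasDerivAt_integral_of_dominated_loc_of_deriv_le
    (F := fun τ x => F (x, τ)) (F' := fun τ x => fderiv ℝ F (x, τ) (0, 1))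
    (bound := fun _ => C) (Metric.closedBall_mem_nhds t one_pos)
    (Filter.Eventually.of_forall fun τ => (hcont τ).aestronglyMeasurable)
    ((hcont t).intervalIntegrable a b)
    (hF'.comp (by fun_prop : Continuous fun x : ℝ => (x, t))).aestronglyMeasurable
    (Filter.Eventually.of_forall fun x hx τ hτ => hC (x, τ) ⟨Set.uIoc_subset_uIcc hx, hτ⟩)
    intervalIntegrable_const
    (Filter.Eventually.of_forall fun x _ τ _ =>
      hasDerivAt_snd_of_differentiable (hF.differentiable one_ne_zero) x τ)).2

/-- Energy balance of a single ISO2b pipe. -/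
lemma iso2b_pipe_energy_balance {L c f : ℝ} (hL : 0 ≤ L) {ρ m : ℝ × ℝ → ℝ}
    (hρ : ContDiff ℝ 1 ρ) (hm : ContDiff ℝ 1 m) (t : ℝ)
    (hmass : ∀ x ∈ Set.Icc (0 : ℝ) L,
      deriv (fun τ => ρ (x, τ)) t + deriv (fun ξ => m (ξ, t)) x = 0)
    (hmom : ∀ x ∈ Set.Icc (0 : ℝ) L,
      deriv (fun τ => m (x, τ)) t + deriv (fun ξ => c ^ 2 * ρ (ξ, t)) x =
        -f * m (x, t) * |m (x, t) / ρ (x, t)|) :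
    HasDerivAt (fun τ => ∫ x in (0 : ℝ)..L, (c ^ 2 * ρ (x, τ) ^ 2 / 2 + m (x, τ) ^ 2 / 2))
      (c ^ 2 * ρ (0, t) * m (0, t) - c ^ 2 * ρ (L, t) * m (L, t)
        - ∫ x in (0 : ℝ)..L, f * |m (x, t) / ρ (x, t)| * m (x, t) ^ 2) t := by
  have hE : ContDiff ℝ 1 fun p => c ^ 2 * ρ p ^ 2 / 2 + m p ^ 2 / 2 := by fun_prop
  have hG : ContDiff ℝ 1 fun p => c ^ 2 * ρ p * m p := by fun_prop
  have hslice : Continuous fun x : ℝ => (x, t) := by fun_prop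
  have hEt := (continuous_fderiv_apply_const hE (0, 1)).comp' hslice
  have hGx := (continuous_fderiv_apply_const hG (1, 0)).comp' hslice
  have hflux := integral_eq_sub_of_hasDerivAt
    (fun x _ => hasDerivAt_fst_of_differentiable (hG.differentiable one_ne_zero) x t)
    (hGx.intervalIntegrable 0 L)
  have hfriction : ∫ x in (0 : ℝ)..L, f * |m (x, t) / ρ (x, t)| * m (x, t) ^ 2 =
      ∫ x in (0 : ℝ)..L, (-fderiv ℝ (fun p => c ^ 2 * ρ p ^ 2 / 2 + m p ^ 2 / 2) (x, t) (0, 1)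
        - fderiv ℝ (fun p => c ^ 2 * ρ p * m p) (x, t) (1, 0)) := by
    refine integral_congr fun x hx => ?_
    rw [Set.uIcc_of_le hL] at hx
    have hρt := hasDerivAt_snd_of_differentiable (hρ.differentiable one_ne_zero) x t
    have hmt := hasDerivAt_snd_of_differentiable (hm.differentiable one_ne_zero) x t
    have hρx := hasDerivAt_fst_of_differentiable (hρ.differentiable one_ne_zero) x t
    have hmx := hasDerivAt_fst_of_differentiable (hm.differentiable one_ne_zero) x t
    have h₁ := hmass x hx
    have h₂ := hmom x hx
    rw [hρt.deriv, hmx.deriv] at h₁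
    rw [hmt.deriv, (hρx.const_mul (c ^ 2)).deriv] at h₂
    have hEd := (hasDerivAt_snd_of_differentiable (hE.differentiable one_ne_zero) x t).unique
      ((((hρt.pow 2).const_mul (c ^ 2)).div_const 2).add ((hmt.pow 2).div_const 2))
    have hGd := (hasDerivAt_fst_of_differentiable (hG.differentiable one_ne_zero) x t).unique
      ((hρx.const_mul (c ^ 2)).mul hmx)
    simp only [hEd, hGd]
    push_cast
    linear_combination c ^ 2 * ρ (x, t) * h₁ + m (x, t) * h₂
  convert hasDerivAt_intervalIntegral_of_contDiff hE 0 L t using 1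
  rw [hfriction, integral_sub (hEt.fun_neg.intervalIntegrable 0 L) (hGx.intervalIntegrable 0 L),
    integral_neg, hflux]
  ring

/-- Energy balance for two ISO2b pipes coupled by a compressor in
framework FP (prescribed output pressure `pout`) under assumption AV
(constant velocity across the compressor). -/
theorem fp_av_two_pipe_energy_balance
    (L₁ L₂ c lam D : ℝ) (hL₁ : 0 < L₁) (hL₂ : 0 < L₂) (hc : 0 < c)
    (hlam : 0 ≤ lam) (hD : 0 < D) (pout κ : ℝ) (hpout : 0 < pout) (hκ : κ ≠ 0)
    (ρ₁ m₁ ρ₂ m₂ : ℝ × ℝ → ℝ)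
    (hρ₁ : ContDiff ℝ 1 ρ₁) (hm₁ : ContDiff ℝ 1 m₁)
    (hρ₂ : ContDiff ℝ 1 ρ₂) (hm₂ : ContDiff ℝ 1 m₂)
    (hρ₁pos : ∀ x ∈ Set.Icc (0 : ℝ) L₁, ∀ t : ℝ, 0 < ρ₁ (x, t))
    (hρ₂pos : ∀ x ∈ Set.Icc (0 : ℝ) L₂, ∀ t : ℝ, 0 < ρ₂ (x, t))
    (hmass₁ : ∀ x ∈ Set.Icc (0 : ℝ) L₁, ∀ t : ℝ,
      deriv (fun τ => ρ₁ (x, τ)) t + deriv (fun ξ => m₁ (ξ, t)) x = 0)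
    (hmom₁ : ∀ x ∈ Set.Icc (0 : ℝ) L₁, ∀ t : ℝ,
      deriv (fun τ => m₁ (x, τ)) t + deriv (fun ξ => c ^ 2 * ρ₁ (ξ, t)) x =
        -(lam / (2 * D)) * m₁ (x, t) * |m₁ (x, t) / ρ₁ (x, t)|)
    (hmass₂ : ∀ x ∈ Set.Icc (0 : ℝ) L₂, ∀ t : ℝ,
      deriv (fun τ => ρ₂ (x, τ)) t + deriv (fun ξ => m₂ (ξ, t)) x = 0)
    (hmom₂ : ∀ x ∈ Set.Icc (0 : ℝ) L₂, ∀ t : ℝ,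
      deriv (fun τ => m₂ (x, τ)) t + deriv (fun ξ => c ^ 2 * ρ₂ (ξ, t)) x =
        -(lam / (2 * D)) * m₂ (x, t) * |m₂ (x, t) / ρ₂ (x, t)|)
    (hpressure : ∀ t : ℝ, c ^ 2 * ρ₂ (0, t) = pout)
    (hmomentum : ∀ t : ℝ,
      m₁ (L₁, t) = (c ^ 2 * ρ₁ (L₁, t) / pout) ^ (1 / κ) * m₂ (0, t))
    (H : ℝ → ℝ)
    (hH : ∀ t : ℝ, H t =
      (∫ x in (0 : ℝ)..L₁, (c ^ 2 * ρ₁ (x, t) ^ 2 / 2 + m₁ (x, t) ^ 2 / 2)) +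
      ∫ x in (0 : ℝ)..L₂, (c ^ 2 * ρ₂ (x, t) ^ 2 / 2 + m₂ (x, t) ^ 2 / 2)) :
    ∀ t : ℝ, HasDerivAt H
      (c ^ 2 * ρ₁ (0, t) * m₁ (0, t) - c ^ 2 * ρ₂ (L₂, t) * m₂ (L₂, t)
        + (pout - c ^ 2 * ρ₁ (L₁, t) * (c ^ 2 * ρ₁ (L₁, t) / pout) ^ (1 / κ)) * m₂ (0, t)
        - (∫ x in (0 : ℝ)..L₁,
            lam / (2 * D) * |m₁ (x, t) / ρ₁ (x, t)| * m₁ (x, t) ^ 2)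
        - ∫ x in (0 : ℝ)..L₂,
            lam / (2 * D) * |m₂ (x, t) / ρ₂ (x, t)| * m₂ (x, t) ^ 2) t := by
  intro t
  have h₁ := iso2b_pipe_energy_balance hL₁.le hρ₁ hm₁ t (fun x hx => hmass₁ x hx t)
    (fun x hx => hmom₁ x hx t)
  have h₂ := iso2b_pipe_energy_balance hL₂.le hρ₂ hm₂ t (fun x hx => hmass₂ x hx t)
    (fun x hx => hmom₂ x hx t)
  rw [funext hH]
  refine (h₁.add h₂).congr_deriv ?_
  linear_combination m₂ (0, t) * hpressure t - c ^ 2 * ρ₁ (L₁, t) * hmomentum t
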